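/- arXiv:2111.05699 — 2 statements merged into one kernel-verified Lean document; each statement's English description precedes it below -/
import Mathlib

section
/- Let H = (V, E) be a hypergraph, let x̄ ∈ ℝ^E with x̄ ≥ 0 satisfy x̄(δ(𝒫)) ≥ |𝒫| − 1 for every partition 𝒫 of V into nonempty parts, and let k be a positive integer such that k·x̄(e) is an integer for every e ∈ E. Then there exist functions t_1, …, t_k : E → ℕ such that (i) for each i, Σ_{e∈E} t_i(e) = |V| − 1 and Σ_{e∈E[X]} t_i(e) ≤ |X| − 1 for every nonempty X ⊆ V with X ≠ V (i.e., each t_i is a hypertree with multiplicities), and (ii) Σ_{i=1}^{k} t_i(e) ≤ k·x̄(e) for every e ∈ E. -/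
open Finset

variable {V α : Type*}

/-- `F[X]`: the subfamily of hyperedges of `F` contained in `X`. -/
def restrict [DecidableEq V] (edge : α → Finset V) (F : Finset α) (X : Finset V) : Finset α :=
  F.filter fun e => edge e ⊆ X

/-- `F` is a hyperforest of the hypergraph `(V, E)` (with hyperedges given by `edge`). -/
def IsHyperforest [DecidableEq V] (edge : α → Finset V) (E F : Finset α) : Prop :=
  F ⊆ E ∧ ∀ X : Finset V, X.Nonempty → (restrict edge F X).card ≤ X.card - 1

/-- `F` is a hypertree: a hyperforest with `|V| - 1` hyperedges. -/
def IsHypertree [Fintype V] [DecidableEq V] (edge : α → Finset V) (E F : Finset α) : Prop :=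
  IsHyperforest edge E F ∧ F.card = Fintype.card V - 1

/-- `Ps` is a family of pairwise disjoint nonempty sets whose union is `S`. -/
def IsPartitionOf [DecidableEq V] (Ps : Finset (Finset V)) (S : Finset V) : Prop :=
  (∀ P ∈ Ps, P.Nonempty) ∧ (∀ P ∈ Ps, ∀ Q ∈ Ps, P ≠ Q → Disjoint P Q) ∧ Ps.sup id = S

/-- `Ps` is a partition of the vertex set `V` into nonempty parts. -/
def IsPartition [Fintype V] [DecidableEq V] (Ps : Finset (Finset V)) : Prop :=
  IsPartitionOf Ps Finset.univ

/-- `δ_F(Ps)`: hyperedges of `F` contained in the union of the members of `Ps`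
and intersecting at least two members of `Ps`. -/
def delta [DecidableEq V] (edge : α → Finset V) (F : Finset α) (Ps : Finset (Finset V)) :
    Finset α :=
  F.filter fun e => edge e ⊆ Ps.sup id ∧
    2 ≤ (Ps.filter fun P => (edge e ∩ P).Nonempty).card

/-- A monotone submodular integer-valued set function vanishing at the empty set. -/
structure IsPolymatroidFunction [DecidableEq α] (b : Finset α → ℤ) : Prop where
  empty : b ∅ = 0
  mono : ∀ A B, A ⊆ B → b A ≤ b B
  submodular : ∀ A B, b (A ∪ B) + b (A ∩ B) ≤ b A + b B

namespace IsPolymatroidFunction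

variable [DecidableEq α] {b c : Finset α → ℤ}

theorem add (hb : IsPolymatroidFunction b) (hc : IsPolymatroidFunction c) :
    IsPolymatroidFunction fun A => b A + c A where
  empty := by simp [hb.empty, hc.empty]
  mono A B h := add_le_add (hb.mono A B h) (hc.mono A B h)
  submodular A B := by linarith [hb.submodular A B, hc.submodular A B]

theorem natCast_mul (hb : IsPolymatroidFunction b) (k : ℕ) :
    IsPolymatroidFunction fun A => (k : ℤ) * b A where
  empty := by simp [hb.empty]
  mono A B h := mul_le_mul_of_nonneg_left (hb.mono A B h) k.cast_nonneg
  submodular A B := by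
    rw [← mul_add, ← mul_add]
    exact mul_le_mul_of_nonneg_left (hb.submodular A B) k.cast_nonneg

theorem const_of_nonempty {m : ℤ} (hm : 0 ≤ m) :
    IsPolymatroidFunction fun A : Finset α => if A = ∅ then 0 else m where
  empty := by simp
  mono A B h := by
    by_cases hA : A = ∅
    · simp only [hA, if_true]
      split_ifs <;> simp [hm]
    · have hB : B ≠ ∅ := fun hB => hA (subset_empty.1 (hB ▸ h))
      simp [hA, hB]
  submodular A B := by
    by_cases hA : A = ∅
    · simp [hA]
    · by_cases hB : B = ∅
      · simp [hB]
      · have hAB : A ∪ B ≠ ∅ := by simp [union_eq_empty, hA]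
        simp only [hA, hB, hAB, if_false]
        split_ifs <;> linarith

/-- Restricting to the vectors whose value at `s` is `a` leaves a polymatroid function. -/
theorem fix_value (hb : IsPolymatroidFunction b) {s : α} {a : ℤ} (ha : a ≤ b {s}) :
    IsPolymatroidFunction fun A => min (b A) (b (insert s A) - a) where
  empty := by
    simp only [hb.empty, insert_empty_eq]
    exact min_eq_left (by linarith)
  mono A B h := min_le_min (hb.mono _ _ h)
    (sub_le_sub_right (hb.mono _ _ (insert_subset_insert s h)) a)
  submodular A B := by
    have h₁ := hb.submodular A B
    have h₂ := hb.submodular (insert s A) B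
    have h₃ := hb.submodular A (insert s B)
    have h₄ := hb.submodular (insert s A) (insert s B)
    have e₁ := insert_union s A B
    have e₂ := union_insert s A B
    have e₃ : insert s A ∪ insert s B = insert s (A ∪ B) :=
      (insert_union_distrib s A B).symm
    have e₄ : insert s A ∩ insert s B = insert s (A ∩ B) := (insert_inter_distrib A B s).symm
    have m₁ := hb.mono (A ∩ B) (insert s A ∩ B) (inter_subset_inter_right (subset_insert s A))
    have m₂ := hb.mono (A ∩ B) (A ∩ insert s B) (inter_subset_inter_left (subset_insert s B))
    rw [e₁] at h₂
    rw [e₂] at h₃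
    rw [e₃, e₄] at h₄
    grind

end IsPolymatroidFunction

/-- Integer decomposition for the sum of two polymatroids (a discrete sandwich theorem). -/
theorem exists_split_of_le_add [DecidableEq α] (S : Finset α) (y : α → ℤ) :
    ∀ b c : Finset α → ℤ, IsPolymatroidFunction b → IsPolymatroidFunction c →
      (∀ e ∈ S, 0 ≤ y e) → (∀ A ⊆ S, ∑ e ∈ A, y e ≤ b A + c A) →
      ∃ t : α → ℤ, (∀ e ∈ S, 0 ≤ t e ∧ t e ≤ y e) ∧
        ∀ A ⊆ S, ∑ e ∈ A, t e ≤ b A ∧ ∑ e ∈ A, (y e - t e) ≤ c A := by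
  induction S using Finset.induction_on with
  | empty =>
    intro b c hb hc _ _
    refine ⟨0, by simp, fun A hA => ?_⟩
    rw [subset_empty.1 hA]
    simp [hb.empty, hc.empty]
  | insert s S hs ih =>
    intro b c hb hc hy hle
    obtain ⟨a, ha₀, ha₁, ha₂, ha₃⟩ : ∃ a : ℤ, 0 ≤ a ∧ a ≤ y s ∧
        (∀ A ⊆ S, ∑ e ∈ A, y e + y s - b A - c (insert s A) ≤ a) ∧
        ∀ B ⊆ S, a ≤ b (insert s B) + c B - ∑ e ∈ B, y e := by
      obtain ⟨A, hA, hmax⟩ := S.powerset.exists_max_image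
        (fun A => ∑ e ∈ A, y e + y s - b A - c (insert s A)) ⟨∅, empty_mem_powerset S⟩
      rw [mem_powerset] at hA
      refine ⟨max 0 (∑ e ∈ A, y e + y s - b A - c (insert s A)), le_max_left _ _, ?_, ?_, ?_⟩
      · refine max_le (hy s (mem_insert_self _ _)) ?_
        linarith [hle A (hA.trans (subset_insert _ _)), hc.mono A _ (subset_insert s A)]
      · exact fun B hB => (hmax B (mem_powerset.2 hB)).trans (le_max_right _ _)
      · intro B hB
        refine max_le ?_ ?_
        · linarith [hle B (hB.trans (subset_insert _ _)), hb.mono B _ (subset_insert s B)]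
        · have h₁ := hb.submodular A (insert s B)
          have h₂ := hc.submodular (insert s A) B
          have hsA : s ∉ A := fun h => hs (hA h)
          have hsB : s ∉ B := fun h => hs (hB h)
          rw [union_insert, inter_insert_of_notMem hsA] at h₁
          rw [insert_union, insert_inter_of_notMem hsB] at h₂
          have hU := hle (insert s (A ∪ B)) (insert_subset_insert s (union_subset hA hB))
          rw [sum_insert (by simp [hsA, hsB])] at hU
          have hI := hle (A ∩ B) ((inter_subset_left.trans hA).trans (subset_insert _ _))
          linarith [sum_union_inter (s₁ := A) (s₂ := B) (f := y)]
    have hbs := ha₃ ∅ (empty_subset S)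
    have hcs := ha₂ ∅ (empty_subset S)
    simp only [insert_empty_eq, sum_empty, hb.empty, hc.empty] at hbs hcs
    obtain ⟨t, ht, htA⟩ := ih _ _ (hb.fix_value (s := s) (a := a) (by linarith))
      (hc.fix_value (s := s) (a := y s - a) (by linarith))
      (fun e he => hy e (mem_insert_of_mem he)) (by
        intro A hA
        have hsA : s ∉ A := fun h => hs (hA h)
        have h₁ := hle A (hA.trans (subset_insert _ _))
        have h₂ := hle (insert s A) (insert_subset_insert s hA)
        rw [sum_insert hsA] at h₂
        have h₃ := ha₂ A hA
        have h₄ := ha₃ A hA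
        grind)
    refine ⟨Function.update t s a, fun e he => ?_, fun A hA => ?_⟩
    · rcases mem_insert.1 he with rfl | he
      · simpa using ⟨ha₀, ha₁⟩
      · rw [Function.update_of_ne (ne_of_mem_of_not_mem he hs)]
        exact ht e he
    · have key : ∀ e ∈ A.erase s, Function.update t s a e = t e := fun e he =>
        Function.update_of_ne (ne_of_mem_erase he) _ _
      have hsum := sum_congr rfl key
      have hsum' : ∑ e ∈ A.erase s, (y e - Function.update t s a e) =
          ∑ e ∈ A.erase s, (y e - t e) := sum_congr rfl fun e he => by rw [key e he]
      obtain ⟨h₁, h₂⟩ := htA (A.erase s) (subset_insert_iff.1 hA)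
      by_cases hsA : s ∈ A
      · rw [insert_erase hsA] at h₁ h₂
        rw [← add_sum_erase A _ hsA, ← add_sum_erase A (fun e => y e - _) hsA, hsum, hsum',
          Function.update_self]
        exact ⟨by linarith [h₁.trans (min_le_right _ _)], by linarith [h₂.trans (min_le_right _ _)]⟩
      · rw [erase_eq_of_notMem hsA] at hsum hsum' h₁ h₂
        rw [hsum, hsum']
        exact ⟨h₁.trans (min_le_left _ _), h₂.trans (min_le_left _ _)⟩

/-- Splitting off `k` vectors of the polymatroid of `b`, with remainder in that of `c`. -/
theorem exists_splits_of_le_mul_add [DecidableEq α] (S : Finset α) {b c : Finset α → ℤ}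
    (hb : IsPolymatroidFunction b) (hc : IsPolymatroidFunction c) (k : ℕ) :
    ∀ y : α → ℤ, (∀ e ∈ S, 0 ≤ y e) → (∀ A ⊆ S, ∑ e ∈ A, y e ≤ k * b A + c A) →
      ∃ t : Fin k → α → ℤ, (∀ i, ∀ e ∈ S, 0 ≤ t i e) ∧ (∀ e ∈ S, ∑ i, t i e ≤ y e) ∧
        (∀ i, ∀ A ⊆ S, ∑ e ∈ A, t i e ≤ b A) ∧ ∑ e ∈ S, (y e - ∑ i, t i e) ≤ c S := by
  induction k with
  | zero =>
    intro y hy hle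
    exact ⟨fun i => i.elim0, fun i => i.elim0, by simpa using hy, fun i => i.elim0,
      by simpa using hle S subset_rfl⟩
  | succ k ih =>
    intro y hy hle
    obtain ⟨u, hu, huA⟩ := exists_split_of_le_add S y _ _ hb ((hb.natCast_mul k).add hc) hy
      (fun A hA => (hle A hA).trans_eq (by push_cast; ring))
    obtain ⟨t, ht₀, ht₁, ht₂, ht₃⟩ := ih (fun e => y e - u e)
      (fun e he => by linarith [(hu e he).2]) (fun A hA => (huA A hA).2)
    refine ⟨Fin.cons u t, Fin.cases (fun e he => (hu e he).1) ht₀, fun e he => ?_,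
      Fin.cases (fun A hA => (huA A hA).1) ht₂, ?_⟩
    · rw [Fin.sum_univ_succ]
      simpa using (by linarith [ht₁ e he] : u e + ∑ i, t i e ≤ y e)
    · simpa [Fin.sum_univ_succ, sub_sub] using ht₃

section CycleSpace

variable [DecidableEq V] (edge : α → Finset V)

/-- The span of the differences of basis vectors at pairs of vertices sharing a hyperedge
of `A`. -/
def differenceSpan (A : Finset α) : Submodule ℚ (V → ℚ) :=
  Submodule.span ℚ
    {d | ∃ e ∈ A, ∃ u ∈ edge e, ∃ v ∈ edge e, d = Pi.single u (1 : ℚ) - Pi.single v (1 : ℚ)}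

theorem differenceSpan_mono {A B : Finset α} (h : A ⊆ B) :
    differenceSpan edge A ≤ differenceSpan edge B :=
  Submodule.span_mono fun _ ⟨e, he, hd⟩ => ⟨e, h he, hd⟩

/-- The rank function of the hypergraphic polymatroid: the number of vertices minus the number
of connected components. -/
noncomputable def hypergraphRank (A : Finset α) : ℤ :=
  Module.finrank ℚ (differenceSpan edge A)

theorem isPolymatroidFunction_hypergraphRank [Fintype V] [DecidableEq α] :
    IsPolymatroidFunction (hypergraphRank edge) where
  empty := by
    have h : differenceSpan edge (∅ : Finset α) = ⊥ := by simp [differenceSpan]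
    simp [hypergraphRank, h]
  mono A B h := by
    exact Int.ofNat_le.2 (Submodule.finrank_mono (differenceSpan_mono edge h))
  submodular A B := by
    have h₁ : differenceSpan edge (A ∪ B) ≤ differenceSpan edge A ⊔ differenceSpan edge B := by
      refine Submodule.span_le.2 ?_
      rintro d ⟨e, he, hd⟩
      rcases mem_union.1 he with he | he
      · exact Submodule.mem_sup_left (Submodule.subset_span ⟨e, he, hd⟩)
      · exact Submodule.mem_sup_right (Submodule.subset_span ⟨e, he, hd⟩)
    have h₂ : differenceSpan edge (A ∩ B) ≤ differenceSpan edge A ⊓ differenceSpan edge B :=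
      le_inf (differenceSpan_mono edge inter_subset_left)
        (differenceSpan_mono edge inter_subset_right)
    have h₃ := Submodule.finrank_mono h₁
    have h₄ := Submodule.finrank_mono h₂
    have h₅ := Submodule.finrank_sup_add_finrank_inf_eq (differenceSpan edge A)
      (differenceSpan edge B)
    simp only [hypergraphRank]
    omega

theorem hypergraphRank_le_of_subset {X : Finset V} (hX : X.Nonempty)
    {A : Finset α} (hA : ∀ e ∈ A, edge e ⊆ X) : hypergraphRank edge A ≤ X.card - 1 := by
  classical
  obtain ⟨x, hx⟩ := hX
  let D : Finset (V → ℚ) :=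
    (X.erase x).image fun u => Pi.single u (1 : ℚ) - Pi.single x (1 : ℚ)
  have hmem : ∀ u ∈ X, Pi.single u (1 : ℚ) - Pi.single x (1 : ℚ) ∈
      Submodule.span ℚ (D : Set (V → ℚ)) := by
    intro u hu
    by_cases hux : u = x
    · simp [hux]
    · exact Submodule.subset_span (mem_coe.2 (mem_image.2 ⟨u, mem_erase.2 ⟨hux, hu⟩, rfl⟩))
  have hle : differenceSpan edge A ≤ Submodule.span ℚ (D : Set (V → ℚ)) := by
    refine Submodule.span_le.2 ?_
    rintro d ⟨e, he, u, hu, v, hv, rfl⟩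
    simpa using Submodule.sub_mem _ (hmem u (hA e he hu)) (hmem v (hA e he hv))
  have h₁ := Submodule.finrank_mono hle
  have h₂ := finrank_span_finset_le_card (R := ℚ) D
  have h₃ : D.card ≤ X.card - 1 := card_image_le.trans_eq (card_erase_of_mem hx)
  have h₄ := card_pos.2 ⟨x, hx⟩
  simp only [hypergraphRank, Set.finrank] at *
  omega

/-- The partition into connected components of the hyperedges in `A`. -/
theorem exists_partition_card_le_rank [Fintype V] [DecidableEq α] (E A : Finset α) :
    ∃ Ps : Finset (Finset V), IsPartition Ps ∧ delta edge E Ps ⊆ E \ A ∧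
      (Fintype.card V : ℤ) - Ps.card ≤ hypergraphRank edge A := by
  classical
  let W := differenceSpan edge A
  let f : V → (V → ℚ) ⧸ W := fun v => W.mkQ (Pi.single v 1)
  let fiber : (V → ℚ) ⧸ W → Finset V := fun q => univ.filter fun v => f v = q
  have hinj : Set.InjOn fiber (univ.image f : Finset _) := by
    intro q hq q' _ h
    obtain ⟨v, -, rfl⟩ := mem_image.1 hq
    have hv : v ∈ fiber (f v) := by simp [fiber]
    rw [h] at hv
    simpa [fiber] using hv
  refine ⟨(univ.image f).image fiber, ⟨?_, ?_, ?_⟩, ?_, ?_⟩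
  · simp only [mem_image, mem_univ, true_and]
    rintro P ⟨_, ⟨v, rfl⟩, rfl⟩
    exact ⟨v, by simp [fiber]⟩
  · simp only [mem_image, mem_univ, true_and]
    rintro P ⟨q, -, rfl⟩ Q ⟨q', -, rfl⟩ hne
    refine disjoint_left.2 fun v hv hv' => hne ?_
    simp only [fiber, mem_filter, mem_univ, true_and] at hv hv'
    rw [← hv, ← hv']
  · refine eq_univ_iff_forall.2 fun v => mem_sup.2 ⟨fiber (f v), ?_, by simp [fiber]⟩
    exact mem_image_of_mem _ (mem_image_of_mem _ (mem_univ v))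
  · intro e he
    obtain ⟨heE, -, hcard⟩ := mem_filter.1 he
    refine mem_sdiff.2 ⟨heE, fun heA => ?_⟩
    obtain ⟨P, hP, Q, hQ, hPQ⟩ := one_lt_card.1 hcard
    simp only [mem_filter, mem_image, mem_univ, true_and] at hP hQ
    obtain ⟨⟨q, -, rfl⟩, u, hu⟩ := hP
    obtain ⟨⟨q', -, rfl⟩, v, hv⟩ := hQ
    simp only [fiber, mem_inter, mem_filter, mem_univ, true_and] at hu hv
    apply hPQ
    rw [← hu.2, ← hv.2]
    congr 1
    exact (Submodule.Quotient.eq W).2 (Submodule.subset_span ⟨e, heA, u, hu.1, v, hv.1, rfl⟩)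
  · rw [card_image_of_injOn hinj]
    have hspan : Submodule.span ℚ ((univ.image f : Finset _) : Set ((V → ℚ) ⧸ W)) = ⊤ := by
      have h := (Pi.basisFun ℚ V).span_eq
      have h' := congrArg (Submodule.map W.mkQ) h
      rw [Submodule.map_span, Submodule.map_top, Submodule.range_mkQ, ← Set.range_comp] at h'
      rw [← h']
      congr 1
      ext q
      simp [f]
    have h₁ := finrank_span_finset_le_card (R := ℚ) (univ.image f)
    rw [Set.finrank, hspan, finrank_top] at h₁
    have h₂ := W.finrank_quotient_add_finrank
    rw [Module.finrank_pi] at h₂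
    have h₃ : hypergraphRank edge A = Module.finrank ℚ W := rfl
    omega

end CycleSpace

/-- if `x̄ ≥ 0` satisfies all partition inequalities and `k·x̄` is integral,
then there are `k` hypertrees with multiplicities `t_1, …, t_k` with
`∑_i t_i(e) ≤ k·x̄(e)` for every hyperedge `e`. -/
theorem partition_point_dominates_hypertrees [Fintype V] [DecidableEq V] [DecidableEq α]
    (edge : α → Finset V) (E : Finset α)
    (hV : 1 ≤ Fintype.card V) (hE : ∀ e ∈ E, 2 ≤ (edge e).card)
    (x : α → ℝ) (hx : ∀ e ∈ E, 0 ≤ x e)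
    (hpart : ∀ Ps : Finset (Finset V), IsPartition Ps →
      (Ps.card : ℝ) - 1 ≤ ∑ e ∈ delta edge E Ps, x e)
    (k : ℕ) (hk : 0 < k) (hint : ∀ e ∈ E, ∃ n : ℤ, (k : ℝ) * x e = n) :
    ∃ t : Fin k → α → ℕ,
      (∀ i, (∑ e ∈ E, t i e) = Fintype.card V - 1 ∧
        ∀ X : Finset V, X.Nonempty → X ≠ Finset.univ →
          (∑ e ∈ restrict edge E X, t i e) ≤ X.card - 1) ∧
      (∀ e ∈ E, (∑ i, (t i e : ℝ)) ≤ (k : ℝ) * x e) := by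
  choose! n hn using hint
  have hn₀ : ∀ e ∈ E, 0 ≤ n e := by
    intro e he
    have h : (0 : ℝ) ≤ n e := hn e he ▸ mul_nonneg k.cast_nonneg (hx e he)
    exact_mod_cast h
  have huniv : (univ : Finset V).Nonempty := card_pos.1 hV
  set M : ℤ := k * ((Fintype.card V : ℤ) - 1) with hM
  have hcut : ∀ A ⊆ E, ∑ e ∈ A, n e ≤ k * hypergraphRank edge A + (∑ e ∈ E, n e - M) := by
    intro A hA
    obtain ⟨Ps, hPs, hδ, hrank⟩ := exists_partition_card_le_rank edge E A
    have h₁ : (k : ℤ) * ((Ps.card : ℤ) - 1) ≤ ∑ e ∈ delta edge E Ps, n e := by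
      have h := mul_le_mul_of_nonneg_left (hpart Ps hPs) (k.cast_nonneg (α := ℝ))
      have h' : ∑ e ∈ delta edge E Ps, (k : ℝ) * x e = ∑ e ∈ delta edge E Ps, (n e : ℝ) :=
        sum_congr rfl fun e he => hn e (mem_filter.1 he).1
      rw [mul_sum, h'] at h
      exact_mod_cast h
    have h₂ : ∑ e ∈ delta edge E Ps, n e ≤ ∑ e ∈ E \ A, n e :=
      sum_le_sum_of_subset_of_nonneg hδ fun e he _ => hn₀ e (mem_sdiff.1 he).1
    have h₃ := sum_sdiff hA (f := n)
    have h₄ := mul_le_mul_of_nonneg_left hrank (k.cast_nonneg (α := ℤ))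
    rw [hM]
    linarith
  have hb := isPolymatroidFunction_hypergraphRank edge
  have hc₀ : 0 ≤ ∑ e ∈ E, n e - M := by simpa [hb.empty] using hcut ∅ (empty_subset E)
  obtain ⟨t, ht₀, ht₁, ht₂, ht₃⟩ := exists_splits_of_le_mul_add E hb
    (IsPolymatroidFunction.const_of_nonempty hc₀) k n hn₀ (by
      intro A hA
      by_cases h : A = ∅
      · simp [h, hb.empty]
      · simpa [h] using hcut A hA)
  have hnat : ∀ i, ∀ A ⊆ E, ((∑ e ∈ A, (t i e).toNat : ℕ) : ℤ) = ∑ e ∈ A, t i e := by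
    intro i A hA
    rw [Nat.cast_sum]
    exact sum_congr rfl fun e he => Int.toNat_of_nonneg (ht₀ i e (hA he))
  have hrE := hypergraphRank_le_of_subset edge huniv (A := E) fun e _ => subset_univ _
  rw [card_univ] at hrE
  have hupper : ∀ i, ∑ e ∈ E, t i e ≤ (Fintype.card V : ℤ) - 1 := fun i =>
    (ht₂ i E subset_rfl).trans hrE
  have hlower : M ≤ ∑ i, ∑ e ∈ E, t i e := by
    rw [sum_comm]
    rw [sum_sub_distrib] at ht₃
    by_cases h : E = ∅
    · simpa [h] using hc₀
    · simp only [h, if_false] at ht₃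
      linarith
  have hsize : ∀ i, ∑ e ∈ E, t i e = (Fintype.card V : ℤ) - 1 := by
    have hsum : ∑ i, ∑ e ∈ E, t i e = ∑ _i : Fin k, ((Fintype.card V : ℤ) - 1) :=
      le_antisymm (sum_le_sum fun i _ => hupper i) 
        (by rw [Fin.sum_const, nsmul_eq_mul]; exact hlower)
    exact fun i => (sum_eq_sum_iff_of_le fun i _ => hupper i).1 hsum i (mem_univ i)
  refine ⟨fun i e => (t i e).toNat, fun i => ⟨?_, fun X hX _ => ?_⟩, fun e he => ?_⟩
  · have h₁ := hnat i E subset_rfl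
    have h₂ := hsize i
    dsimp only
    omega
  · have hsub : restrict edge E X ⊆ E := filter_subset _ _
    have h₁ := hnat i _ hsub
    have h₂ := ht₂ i _ hsub
    have h₃ := hypergraphRank_le_of_subset edge hX (A := restrict edge E X)
      fun e he => (mem_filter.1 he).2
    have h₄ := card_pos.2 hX
    dsimp only
    omega
  · rw [hn e he]
    have h : (∑ i, ((t i e).toNat : ℤ)) ≤ n e :=
      (sum_congr rfl fun i _ => Int.toNat_of_nonneg (ht₀ i e he)).trans_le (ht₁ e he)
    exact_mod_cast h
end

section
/- Let H = (V, E) be a hypergraph, let x̄ ∈ ℝ^E with x̄ ≥ 0, let β ≥ 0 be a real number, fix r ∈ V, and define f on nonempty subsets S ⊆ V by f(S) = β + x̄(E[S]) if r ∉ S and f(S) = x̄(E[S]) if r ∈ S. Let y : V → ℝ satisfy y(S) ≥ f(S) for every nonempty S ⊆ V (where y(S) = Σ_{v∈S} y(v)). If S and T are nonempty subsets of V with S ∩ T ≠ ∅, y(S) = f(S), and y(T) = f(T), then y(S ∪ T) = f(S ∪ T). -/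
open Finset

variable {V α : Type*}

/-- The function `f(S) = β·[r ∉ S] + x̄(E[S])` used in the greedy/uncrossing algorithm. -/
def fAux [DecidableEq V] (edge : α → Finset V) (E : Finset α) (x : α → ℝ) (β : ℝ)
    (r : V) (S : Finset V) : ℝ :=
  (if r ∈ S then 0 else β) + ∑ e ∈ restrict edge E S, x e

/-- `fAux` is supermodular when `x` is nonnegative on `E`. -/
theorem fAux_add_le_union_add_inter [DecidableEq V] (edge : α → Finset V) (E : Finset α)
    (x : α → ℝ) (hx : ∀ e ∈ E, 0 ≤ x e) (β : ℝ) (r : V) (S T : Finset V) :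
    fAux edge E x β r S + fAux edge E x β r T ≤
      fAux edge E x β r (S ∪ T) + fAux edge E x β r (S ∩ T) := by
  have h_edges : ∑ e ∈ restrict edge E S, x e + ∑ e ∈ restrict edge E T, x e ≤
      ∑ e ∈ restrict edge E (S ∪ T), x e + ∑ e ∈ restrict edge E (S ∩ T), x e := by
    simp only [_root_.restrict, sum_filter, ← sum_add_distrib]
    refine sum_le_sum fun e he => ?_
    have hxe := hx e he
    by_cases hS : edge e ⊆ S
    · have hU : edge e ⊆ S ∪ T := hS.trans subset_union_left
      simp [hS, hU, subset_inter_iff]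
    · by_cases hT : edge e ⊆ T
      · have hU : edge e ⊆ S ∪ T := hT.trans subset_union_right
        simp [hS, hT, hU, subset_inter_iff]
      · simp only [hS, hT, subset_inter_iff, false_and, if_false, add_zero]
        split_ifs <;> simp [hxe]
  have h_root : (if r ∈ S then 0 else β) + (if r ∈ T then 0 else β) =
      (if r ∈ S ∪ T then 0 else β) + (if r ∈ S ∩ T then 0 else β) := by
    by_cases hS : r ∈ S <;> by_cases hT : r ∈ T <;> simp [hS, hT]
  simp only [fAux]
  linarith

/-- if `S` and `T` are intersecting tight sets for a feasible `y`,
then `S ∪ T` is tight. -/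
theorem tight_sets_union [Fintype V] [DecidableEq V] [DecidableEq α]
    (edge : α → Finset V) (E : Finset α)
    (hV : 1 ≤ Fintype.card V) (hE : ∀ e ∈ E, 2 ≤ (edge e).card)
    (x : α → ℝ) (hx : ∀ e ∈ E, 0 ≤ x e) (β : ℝ) (hβ : 0 ≤ β) (r : V)
    (y : V → ℝ)
    (hy : ∀ S : Finset V, S.Nonempty → fAux edge E x β r S ≤ ∑ v ∈ S, y v)
    (S T : Finset V) (hS : S.Nonempty) (hT : T.Nonempty) (hST : (S ∩ T).Nonempty)
    (hStight : ∑ v ∈ S, y v = fAux edge E x β r S)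
    (hTtight : ∑ v ∈ T, y v = fAux edge E x β r T) :
    ∑ v ∈ S ∪ T, y v = fAux edge E x β r (S ∪ T) := by
  have h_super := fAux_add_le_union_add_inter edge E x hx β r S T
  have h_sum := sum_union_inter (s₁ := S) (s₂ := T) (f := y)
  have h_union := hy (S ∪ T) (hS.mono subset_union_left)
  have h_inter := hy (S ∩ T) hST
  linarith
end
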